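/- Assume the Conrey–Iwaniec bound L(1,χ_d) ≥ 1/(log d)^18 holds for all fundamental discriminants -d < 0. If -d is a fundamental discriminant whose class group C(-d) has one class per genus (i.e., h(-d) = 2^(g-1) where g is the number of prime divisors of d), then d ≤ d₆₆, the product of the first 66 primes. -/

import Mathlib

open Real Finset

/-- `D` is a fundamental discriminant: either `D ≡ 1 (mod 4)` and `D` is squarefree, or
`D = 4m` with `m` squarefree and `m ≡ 2` or `3 (mod 4)`. -/
def IsFundamentalDiscriminant (D : ℤ) : Prop :=
  (D % 4 = 1 ∧ Squarefree D) ∨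
    (D % 4 = 0 ∧ Squarefree (D / 4) ∧ ((D / 4) % 4 = 2 ∨ (D / 4) % 4 = 3))

/-- `χ` is the quadratic Dirichlet character of conductor `d` attached to `ℚ(√-d)`:
it agrees with the Legendre symbol `((-d)/p)` at all odd primes `p ∤ d`. -/
def IsQuadFieldChar (d : ℕ) [NeZero d] (χ : DirichletCharacter ℂ d) : Prop :=
  ∀ p : ℕ, (hp : p.Prime) → p ≠ 2 → ¬ p ∣ d →
    χ p = (@legendreSym p ⟨hp⟩ (-(d : ℤ)) : ℂ)

lemma prod_nth_prime_count (n : ℕ) :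
    ∏ i ∈ range (Nat.count Nat.Prime n), Nat.nth Nat.Prime i
      = ∏ p ∈ (range n).filter Nat.Prime, p := by
  induction n with
  | zero => simp
  | succ n ih =>
    rw [Nat.count_succ, range_add_one, filter_insert]
    by_cases h : Nat.Prime n
    · rw [if_pos h, if_pos h, prod_range_succ, ih, prod_insert (by simp), Nat.nth_count h, mul_comm]
    · rw [if_neg h, if_neg h, add_zero, ih]

lemma d66_ge : 10 ^ 130 ≤ ∏ i ∈ Finset.range 66, Nat.nth Nat.Prime i := by
  have h : Nat.count Nat.Prime 318 = 66 := by decide +kernel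
  rw [← h, prod_nth_prime_count]
  decide +kernel

lemma prod_nth_le_prod (g : ℕ) : ∀ s : Finset ℕ, (∀ p ∈ s, p.Prime) → s.card = g →
    ∏ i ∈ range g, Nat.nth Nat.Prime i ≤ ∏ p ∈ s, p := by
  induction g with
  | zero => intro s hs h; rw [card_eq_zero] at h; subst h; simp
  | succ g ih =>
    intro s hs h
    have hne : s.Nonempty := by rw [← card_pos]; omega
    have hm := s.max'_mem hne
    set q := s.max' hne with hq
    have hcard : (s.erase q).card = g := by rw [card_erase_of_mem hm]; omega
    rw [prod_range_succ, ← prod_erase_mul s _ hm]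
    refine Nat.mul_le_mul (ih _ (fun p hp => hs p (mem_of_mem_erase hp)) hcard) ?_
    have hle : g ≤ Nat.count Nat.Prime q := by
      rw [Nat.count_eq_card_filter_range, ← hcard]
      apply card_le_card
      intro p hp
      rw [mem_filter, mem_range]
      exact ⟨lt_of_le_of_ne (le_max' _ _ (mem_of_mem_erase hp)) (ne_of_mem_erase hp),
        hs p (mem_of_mem_erase hp)⟩
    calc Nat.nth Nat.Prime g ≤ Nat.nth Nat.Prime (Nat.count Nat.Prime q) :=
          Nat.nth_monotone Nat.infinite_setOfPred_prime hle
      _ = q := Nat.nth_count (hs q hm)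

lemma d_ge (d : ℕ) (hd0 : d ≠ 0) (hd : ∏ i ∈ Finset.range 66, Nat.nth Nat.Prime i < d) :
    10 ^ 130 * 64 ^ (d.primeFactors.card - 66) ≤ d := by
  by_cases hg : d.primeFactors.card ≤ 66
  · rw [Nat.sub_eq_zero_of_le hg]
    have := d66_ge
    omega
  · obtain ⟨k, hk⟩ : ∃ k, d.primeFactors.card = 66 + k := ⟨d.primeFactors.card - 66, by omega⟩
    have h1 := prod_nth_le_prod _ d.primeFactors (fun p hp => Nat.prime_of_mem_primeFactors hp) hk
    have h2 : ∏ p ∈ d.primeFactors, p ≤ d :=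
      Nat.le_of_dvd (Nat.pos_of_ne_zero hd0) (Nat.prod_primeFactors_dvd d)
    rw [hk, Nat.add_sub_cancel_left]
    refine le_trans ?_ (h1.trans h2)
    rw [prod_range_add]
    refine Nat.mul_le_mul d66_ge ?_
    calc 64 ^ k = ∏ i ∈ range k, 64 := by simp
      _ ≤ _ := prod_le_prod' (fun i _ => by
        have := Nat.add_two_le_nth_prime (66 + i)
        omega)

lemma numeric (d g : ℕ) (h1 : 10 ^ 130 * 64 ^ (g - 66) ≤ d)
    (h2 : √(d : ℝ) ≤ π * 2 ^ (g - 1) * (Real.log d) ^ 18) : False := by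
  have hB : (0 : ℝ) < 10 ^ 130 := by positivity
  set k := g - 66 with hk
  set x0 := Real.log (10 ^ 130) with hx0
  set x := Real.log d with hx
  have h1' : (10 : ℝ) ^ 130 * 64 ^ k ≤ d := by exact_mod_cast h1
  have hdpos : (0 : ℝ) < d := lt_of_lt_of_le (by positivity) h1'
  have hx0u : x0 ≤ 301 := by
    rw [hx0, Real.log_le_iff_le_exp hB]
    have := Real.exp_one_gt_d9
    calc (10 : ℝ) ^ 130 ≤ (2.718 ^ 7) ^ 43 := by norm_num
      _ ≤ ((exp 1) ^ 7) ^ 43 := by gcongr; linarith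
      _ = exp 301 := by rw [← Real.exp_nat_mul, ← Real.exp_nat_mul]; norm_num
  have hx0l : 200 ≤ x0 := by
    rw [hx0, Real.le_log_iff_exp_le hB]
    have := Real.exp_one_lt_d9
    calc exp 200 = (exp 1) ^ 200 := by rw [← Real.exp_nat_mul]; norm_num
      _ ≤ 2.72 ^ 200 := by gcongr; linarith
      _ ≤ _ := by norm_num
  have hxk : x0 + 6 * (k * Real.log 2) ≤ x := by
    rw [hx0, hx]
    have := Real.log_le_log (by positivity) h1'
    rw [Real.log_mul (by positivity) (by positivity), Real.log_pow (64 : ℝ) k,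
      show (64 : ℝ) = 2 ^ 6 by norm_num, Real.log_pow (2 : ℝ) 6] at this
    push_cast at this
    linarith
  have hl2 : 0 < Real.log 2 := Real.log_pos (by norm_num)
  have hxx : x0 ≤ x := by
    have : 0 ≤ k * Real.log 2 := by positivity
    linarith
  have h2k : (2 : ℝ) ^ k ≤ exp ((x - x0) / 6) := by
    rw [← Real.exp_log (by norm_num : (0:ℝ) < 2), ← Real.exp_nat_mul]
    apply Real.exp_le_exp.2
    linarith
  have hx18 : x ^ 18 ≤ x0 ^ 18 * exp ((x - x0) / 3) := by
    have hx0p : 0 < x0 := by linarith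
    have : x ≤ x0 * exp ((x - x0) / 54) := by
      have h3 : (x - x0) / 54 + 1 ≤ exp ((x - x0) / 54) := Real.add_one_le_exp _
      have h4 : x0 * ((x - x0) / 54 + 1) ≤ x0 * exp ((x - x0) / 54) := by gcongr
      nlinarith
    calc x ^ 18 ≤ (x0 * exp ((x - x0) / 54)) ^ 18 := by gcongr
      _ = _ := by rw [mul_pow, ← Real.exp_nat_mul]; congr 2; push_cast; ring
  have hsq : √(d : ℝ) = 10 ^ 65 * exp ((x - x0) / 2) := by
    have : (d : ℝ) = (10 ^ 65 * exp ((x - x0) / 2)) ^ 2 := by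
      rw [mul_pow, ← Real.exp_nat_mul]
      have : ((2 : ℕ) : ℝ) * ((x - x0) / 2) = x - x0 := by push_cast; ring
      rw [this, Real.exp_sub, hx, hx0, Real.exp_log hdpos, Real.exp_log hB]
      field_simp
    rw [this, Real.sqrt_sq (by positivity)]
  have h2g : (2 : ℝ) ^ (g - 1) ≤ 2 ^ 65 * 2 ^ k := by
    rw [← pow_add]
    apply pow_le_pow_right₀ (by norm_num)
    omega
  have hE : (0 : ℝ) < exp ((x - x0) / 2) := exp_pos _
  have key : √(d : ℝ) ≤ (3.15 * 2 ^ 65 * 301 ^ 18) * exp ((x - x0) / 2) := by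
    calc √(d : ℝ) ≤ π * 2 ^ (g - 1) * x ^ 18 := h2
      _ ≤ 3.15 * (2 ^ 65 * exp ((x - x0) / 6)) * (301 ^ 18 * exp ((x - x0) / 3)) := by
        have : 0 ≤ x := by linarith
        have h5 : (2 : ℝ) ^ (g - 1) ≤ 2 ^ 65 * exp ((x - x0) / 6) := h2g.trans (by gcongr)
        have h6 : x ^ 18 ≤ 301 ^ 18 * exp ((x - x0) / 3) := hx18.trans (by gcongr)
        have := Real.pi_lt_d2
        gcongr
      _ = _ := by
        rw [show (x - x0) / 2 = (x - x0) / 6 + (x - x0) / 3 by ring, Real.exp_add]; ring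
  rw [hsq] at key
  have := le_of_mul_le_mul_right key hE
  norm_num at this

open Filter Topology in
lemma L_le_residue (K : Type) [Field K] [NumberField K] (d : ℕ) [NeZero d]
    (χ : DirichletCharacter ℂ d) (hχ : χ ≠ 1)
    (h : ∀ n : ℕ, n ≠ 0 → ‖χ.zetaMul n‖ ≤
      Nat.card {I : Ideal (NumberField.RingOfIntegers K) // Ideal.absNorm I = n}) :
    (DirichletCharacter.LFunction χ 1).re ≤ NumberField.dedekindZeta_residue K := by
  refine (Complex.re_le_norm _).trans ?_
  have hmap : Tendsto (fun s : ℝ => (s : ℂ)) (𝓝[>] 1) (𝓝[≠] 1) := by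
    apply tendsto_nhdsWithin_of_tendsto_nhds_of_eventually_within
    · exact (Complex.continuous_ofReal.tendsto' 1 1 (by simp)).mono_left nhdsWithin_le_nhds
    · filter_upwards [self_mem_nhdsWithin] with s hs
      simp only [Set.mem_compl_iff, Set.mem_singleton_iff]
      intro h1
      rw [Complex.ofReal_eq_one] at h1
      exact (ne_of_gt hs) h1
  have h1 : Tendsto (fun s : ℝ => ‖((s : ℂ) - 1) * riemannZeta s * χ.LFunction s‖) (𝓝[>] 1)
      (𝓝 ‖χ.LFunction 1‖) := by
    have ha := riemannZeta_residue_one.comp hmap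
    have hb : Tendsto (fun s : ℝ => χ.LFunction s) (𝓝[>] 1) (𝓝 (χ.LFunction 1)) :=
      ((DirichletCharacter.differentiable_LFunction hχ).continuous.tendsto 1).comp
        (hmap.mono_right nhdsWithin_le_nhds)
    have := (ha.mul hb).norm
    simpa using this
  have hres := NumberField.dedekindZeta_residue_pos K
  have h2 := (NumberField.tendsto_sub_one_mul_dedekindZeta_nhdsGT K).norm
  have h2' : Tendsto (fun s : ℝ => ‖((s : ℂ) - 1) * NumberField.dedekindZeta K s‖) (𝓝[>] 1)
      (𝓝 (NumberField.dedekindZeta_residue K)) := by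
    rw [Complex.norm_real, Real.norm_of_nonneg hres.le] at h2
    exact h2
  refine le_of_tendsto_of_tendsto h1 h2' ?_
  filter_upwards [self_mem_nhdsWithin, h2'.eventually (lt_mem_nhds hres)] with s hs hs2
  have hs1 : 1 < (s : ℂ).re := by simpa using hs
  have hs0 : (s : ℂ) ≠ 0 := by
    intro h0; rw [h0] at hs1; simp at hs1; linarith
  have e1 : ‖((s : ℂ) - 1) * riemannZeta s * χ.LFunction s‖
      = ‖(s : ℂ) - 1‖ * ‖riemannZeta s * χ.LFunction s‖ := by rw [mul_assoc, norm_mul]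
  have e2 : ‖((s : ℂ) - 1) * NumberField.dedekindZeta K s‖
      = ‖(s : ℂ) - 1‖ * ‖NumberField.dedekindZeta K s‖ := norm_mul _ _
  rw [e1, e2]
  refine mul_le_mul_of_nonneg_left ?_ (norm_nonneg _)
  have hzeta : riemannZeta s * χ.LFunction s = LSeries χ.zetaMul s := by
    rw [DirichletCharacter.zetaMul, ← ArithmeticFunction.coe_mul, LSeries_convolution']
    · rw [χ.LFunction_eq_LSeries hs1]
      congr 1
      · simp_rw [← ArithmeticFunction.LSeries_zeta_eq_riemannZeta hs1, ← ArithmeticFunction.natCoe_apply]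
      · exact LSeries_congr χ.apply_eq_toArithmeticFunction_apply s
    · exact ArithmeticFunction.LSeriesSummable_zeta_iff.mpr hs1
    · exact (LSeriesSummable_congr _
        fun h ↦ (χ.apply_eq_toArithmeticFunction_apply h).symm).mpr <|
        ZMod.LSeriesSummable_of_one_lt_re χ hs1
  rw [hzeta]
  have hsum : LSeriesSummable (fun n ↦ (Nat.card {I : Ideal (NumberField.RingOfIntegers K) //
      Ideal.absNorm I = n} : ℂ)) s := by
    by_contra hns
    have h0 : NumberField.dedekindZeta K s = 0 := by
      rw [NumberField.dedekindZeta, LSeries]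
      exact tsum_eq_zero_of_not_summable hns
    rw [h0] at hs2
    simp at hs2
  have hnn : ∀ n, LSeries.term (fun n ↦ (Nat.card {I : Ideal (NumberField.RingOfIntegers K) //
      Ideal.absNorm I = n} : ℂ)) s n = ((‖LSeries.term (fun n ↦
      (Nat.card {I : Ideal (NumberField.RingOfIntegers K) //
      Ideal.absNorm I = n} : ℂ)) s n‖ : ℝ) : ℂ) := by
    intro n
    rw [LSeries.norm_term_eq, LSeries.term]
    split_ifs with hn
    · simp
    · rw [Complex.ofReal_div, Complex.ofReal_cpow (by positivity)]
      simp
  have hz : ‖NumberField.dedekindZeta K s‖ = ∑' n, ‖LSeries.term (fun n ↦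
      (Nat.card {I : Ideal (NumberField.RingOfIntegers K) //
      Ideal.absNorm I = n} : ℂ)) s n‖ := by
    rw [NumberField.dedekindZeta, LSeries, tsum_congr hnn, ← Complex.ofReal_tsum, Complex.norm_real,
      Real.norm_of_nonneg (tsum_nonneg fun _ => norm_nonneg _)]
  rw [hz, LSeries]
  have hs3 : Summable fun n => ‖LSeries.term χ.zetaMul s n‖ := 
    (χ.LSeriesSummable_zetaMul hs1).norm
  refine (norm_tsum_le_tsum_norm hs3).trans ?_
  refine hs3.tsum_le_tsum (fun n => ?_) hsum.norm
  rw [LSeries.norm_term_eq, LSeries.norm_term_eq]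
  split_ifs with hn
  · exact le_rfl
  · gcongr
    simpa using h n hn

lemma card_mul_le (K : Type) [Field K] [NumberField K] {m n : ℕ} (hm : m ≠ 0) (hn : n ≠ 0)
    (hmn : m.Coprime n) :
    Nat.card {I : Ideal (NumberField.RingOfIntegers K) // Ideal.absNorm I = m} *
    Nat.card {I : Ideal (NumberField.RingOfIntegers K) // Ideal.absNorm I = n} ≤
    Nat.card {I : Ideal (NumberField.RingOfIntegers K) // Ideal.absNorm I = m * n} := by
  rw [← Nat.card_prod]
  have : Finite {I : Ideal (NumberField.RingOfIntegers K) // Ideal.absNorm I = m * n} :=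
    (Ideal.finite_setOfPred_absNorm_eq (m * n)).to_subtype
  have key : ∀ I J : Ideal (NumberField.RingOfIntegers K), Ideal.absNorm J = n →
      Ideal.absNorm I = m → 
      I = I * J ⊔ Ideal.span {(m : NumberField.RingOfIntegers K)} := by
    intro I J hJ hI
    apply le_antisymm
    · have h1 : Ideal.span {(m : NumberField.RingOfIntegers K)} ⊔ 
          Ideal.span {(n : NumberField.RingOfIntegers K)} = ⊤ := by
        rw [← Ideal.isCoprime_iff_sup_eq, Ideal.isCoprime_span_singleton_iff]
        exact_mod_cast hmn.isCoprime.intCast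
      calc I = I * ⊤ := by simp
        _ = I * Ideal.span {(m : NumberField.RingOfIntegers K)} ⊔ 
          I * Ideal.span {(n : NumberField.RingOfIntegers K)} := by rw [← h1, Ideal.mul_sup]
        _ ≤ Ideal.span {(m : NumberField.RingOfIntegers K)} ⊔ I * J := by
          refine sup_le_sup Ideal.mul_le_right (Ideal.mul_mono_right ?_)
          rw [Ideal.span_singleton_le_iff_mem, ← hJ]
          exact Ideal.absNorm_mem J
        _ = _ := sup_comm _ _
    · refine sup_le Ideal.mul_le_left ?_
      rw [Ideal.span_singleton_le_iff_mem, ← hI]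
      exact Ideal.absNorm_mem I
  refine Nat.card_le_card_of_injective (fun x => ⟨x.1.1 * x.2.1, by
    rw [map_mul, x.1.2, x.2.2]⟩) ?_
  rintro ⟨⟨I, hI⟩, ⟨J, hJ⟩⟩ ⟨⟨I', hI'⟩, ⟨J', hJ'⟩⟩ h
  simp only [Subtype.mk.injEq] at h
  have e1 : I = I' := by rw [key I J hJ hI, key I' J' hJ' hI', h]
  subst e1
  have e2 : J = J' := by
    refine mul_left_cancel₀ ?_ h
    rintro rfl
    simp at hI
    exact hm hI.symm
  subst e2
  rfl

lemma coeff_bound (K : Type) [Field K] [NumberField K] (d : ℕ) [NeZero d]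
    (χ : DirichletCharacter ℂ d) 
    (h : ∀ p k : ℕ, p.Prime → ‖χ.zetaMul (p ^ k)‖ ≤
      Nat.card {I : Ideal (NumberField.RingOfIntegers K) // Ideal.absNorm I = p ^ k})
    (n : ℕ) (hn : n ≠ 0) : ‖χ.zetaMul n‖ ≤
      Nat.card {I : Ideal (NumberField.RingOfIntegers K) // Ideal.absNorm I = n} := by
  induction n using Nat.recOnPosPrimePosCoprime with
  | prime_pow p k hp _ => exact h p k hp
  | zero => exact absurd rfl hn
  | one => simpa using h 2 0 Nat.prime_two
  | coprime a b ha hb hab iha ihb =>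
    rw [χ.isMultiplicative_zetaMul.map_mul_of_coprime hab, norm_mul]
    calc _ ≤ _ := mul_le_mul (iha (by omega)) (ihb (by omega)) (norm_nonneg _) (by positivity)
      _ ≤ _ := by exact_mod_cast card_mul_le K (by omega) (by omega) hab

/-- enough ideals above each prime -/
lemma prime_pow_bound (K : Type) [Field K] [NumberField K] (hrank : Module.finrank ℚ K = 2)
    (d : ℕ) [NeZero d] (χ : DirichletCharacter ℂ d) (p k : ℕ) (hp : p.Prime)
    (h3 : χ p = 0 ∨ χ p = 1 ∨ χ p = -1)
    (h0 : χ p = 0 → ∃ P : Ideal (NumberField.RingOfIntegers K), Ideal.absNorm P = p)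
    (h1 : χ p = 1 → ∃ P Q : Ideal (NumberField.RingOfIntegers K), 
      Ideal.absNorm P = p ∧ Ideal.absNorm Q = p ∧ P ≠ Q) :
    ‖χ.zetaMul (p ^ k)‖ ≤
      Nat.card {I : Ideal (NumberField.RingOfIntegers K) // Ideal.absNorm I = p ^ k} := by
  have : Finite {I : Ideal (NumberField.RingOfIntegers K) // Ideal.absNorm I = p ^ k} :=
    (Ideal.finite_setOfPred_absNorm_eq (p ^ k)).to_subtype
  have hz : χ.zetaMul (p ^ k) = ∑ i ∈ range (k + 1), (χ p) ^ i := by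
    rw [DirichletCharacter.zetaMul, ArithmeticFunction.coe_zeta_mul_apply,
      Nat.sum_divisors_prime_pow hp]
    refine Finset.sum_congr rfl fun i _ => ?_
    have : p ^ i ≠ 0 := pow_ne_zero _ hp.ne_zero
    rw [← χ.apply_eq_toArithmeticFunction_apply this]
    push_cast
    rw [map_pow]
  rw [hz]
  have one_le : (∃ I : Ideal (NumberField.RingOfIntegers K), Ideal.absNorm I = p ^ k) → 
      (1 : ℝ) ≤ Nat.card {I : Ideal (NumberField.RingOfIntegers K) // Ideal.absNorm I = p ^ k} := by
    rintro ⟨I, hI⟩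
    have : Nonempty {I : Ideal (NumberField.RingOfIntegers K) // Ideal.absNorm I = p ^ k} := 
      ⟨⟨I, hI⟩⟩
    exact_mod_cast Nat.card_pos
  rcases h3 with h | h | h
  · obtain ⟨P, hP⟩ := h0 h
    rw [h, Finset.sum_range_succ']
    simp only [ne_eq, Nat.add_eq_zero_iff, one_ne_zero, and_false, not_false_eq_true, zero_pow, sum_const_zero, pow_zero, zero_add, norm_one]
    exact one_le ⟨P ^ k, by rw [map_pow, hP]⟩
  · obtain ⟨P, Q, hP, hQ, hne⟩ := h1 h
    have hPp : Prime P := by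
      rw [Ideal.prime_iff_isPrime]
      · exact Ideal.isPrime_of_irreducible_absNorm (by rw [hP]; exact hp)
      · rintro rfl; simp at hP; exact hp.ne_zero hP.symm
    have hQp : Prime Q := by
      rw [Ideal.prime_iff_isPrime]
      · exact Ideal.isPrime_of_irreducible_absNorm (by rw [hQ]; exact hp)
      · rintro rfl; simp at hQ; exact hp.ne_zero hQ.symm
    have hPQ : ¬ P ∣ Q := by
      intro hd
      exact hne (associated_iff_eq.1 (hPp.associated_of_dvd hQp hd))
    rw [h]
    simp only [one_pow, sum_const, card_range, nsmul_eq_mul, mul_one]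
    rw [Complex.norm_natCast]
    have := Nat.card_le_card_of_injective (α := Fin (k + 1)) 
      (β := {I : Ideal (NumberField.RingOfIntegers K) // Ideal.absNorm I = p ^ k})
      (fun i => ⟨P ^ (i : ℕ) * Q ^ (k - i), by
        rw [map_mul, map_pow, map_pow, hP, hQ, ← pow_add]; congr 1; omega⟩) (by
        intro i j hij
        simp only [Subtype.mk.injEq] at hij
        have em : ∀ a b : ℕ, emultiplicity P (P ^ a * Q ^ b) = a := by
          intro a b
          rw [emultiplicity_mul hPp, emultiplicity_pow_self_of_prime hPp, 
            emultiplicity_eq_zero.2 (fun hd => hPQ (hPp.dvd_of_dvd_pow hd)), add_zero]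
        have := congrArg (emultiplicity P) hij
        rw [em, em] at this
        exact Fin.ext (by exact_mod_cast this))
    rw [Nat.card_fin] at this
    exact_mod_cast this
  · rw [h, neg_one_geom_sum]
    split_ifs with he
    · simp
    · rw [norm_one]
      rw [Nat.even_add_one, not_not] at he
      obtain ⟨j, hj⟩ := he
      refine one_le ⟨Ideal.span {(p : NumberField.RingOfIntegers K)} ^ j, ?_⟩
      rw [map_pow, Ideal.absNorm_span_natCast, NumberField.RingOfIntegers.rank, hrank, ← pow_mul, hj]
      congr 1; omega

lemma exists_basis (K : Type) [Field K] [NumberField K] (hrank : Module.finrank ℚ K = 2) :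
    ∃ B : Module.Basis (Fin 2) ℤ (NumberField.RingOfIntegers K), B 0 = 1 := by
  have hr : Module.finrank ℤ (NumberField.RingOfIntegers K) = 2 := by
    rw [NumberField.RingOfIntegers.rank, hrank]
  let b : Module.Basis (Fin 2) ℤ (NumberField.RingOfIntegers K) :=
    Module.finBasisOfFinrankEq _ _ hr
  obtain ⟨x, hx⟩ : ∃ x, x = b.repr 1 0 := ⟨_, rfl⟩
  obtain ⟨y, hy⟩ : ∃ y, y = b.repr 1 1 := ⟨_, rfl⟩
  have h1 : x • b 0 + y • b 1 = 1 := by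
    have := b.sum_repr 1
    rw [Fin.sum_univ_two] at this
    rw [hx, hy, this]
  have hcop : IsCoprime x y := by
    rw [Int.isCoprime_iff_gcd_eq_one]
    obtain ⟨x', hx'⟩ := Int.gcd_dvd_left x y
    obtain ⟨y', hy'⟩ := Int.gcd_dvd_right x y
    set g := Int.gcd x y with hg
    have h2 : ((g : ℤ) : NumberField.RingOfIntegers K) * (x' • b 0 + y' • b 1) = 1 := by
      rw [← h1, hx', hy', ← zsmul_eq_mul, smul_add, smul_smul, smul_smul]
    have h3 : IsUnit ((g : ℤ) : NumberField.RingOfIntegers K) := IsUnit.of_mul_eq_one _ h2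
    have h4 := h3.map (Algebra.norm ℤ)
    have h5 : Algebra.norm ℤ ((g : ℤ) : NumberField.RingOfIntegers K) = (g : ℤ) ^ 2 := by
      have := Algebra.norm_algebraMap_of_basis b (g : ℤ)
      simpa using this
    rw [h5, isUnit_pow_iff (by norm_num), Int.isUnit_iff] at h4
    omega
  obtain ⟨u, v, huv⟩ := hcop
  have hli : LinearIndependent ℤ ![(1 : NumberField.RingOfIntegers K), (-v) • b 0 + u • b 1] := by
    rw [LinearIndependent.pair_iff]
    intro s t hst
    have h2 : (s * x - t * v) • b 0 + (s * y + t * u) • b 1 = 0 := by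
      rw [← hst, ← h1]; module
    have h3 := (LinearIndependent.pair_iff.1 (by
      have := b.linearIndependent
      have e : (b : Fin 2 → NumberField.RingOfIntegers K) = ![b 0, b 1] := by
        ext i; fin_cases i <;> rfl
      rwa [e] at this)) _ _ h2
    constructor
    · linear_combination u * h3.1 + v * h3.2 - s * huv
    · linear_combination x * h3.2 - y * h3.1 - t * huv
  refine ⟨Module.Basis.mk hli ?_, by simp⟩
  rw [← b.span_eq, Submodule.span_le]
  rintro _ ⟨i, rfl⟩
  simp only [Matrix.range_cons, Matrix.range_empty, Set.union_empty, Set.singleton_union, SetLike.mem_coe]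
  rw [Submodule.mem_span_pair]
  fin_cases i
  · refine ⟨u, -y, ?_⟩
    rw [← h1]
    have : b 0 = (u * x + v * y) • b 0 := by rw [huv, one_smul]
    simp only [Fin.zero_eta]
    conv_rhs => rw [this]
    module
  · refine ⟨v, x, ?_⟩
    rw [← h1]
    have : b 1 = (u * x + v * y) • b 1 := by rw [huv, one_smul]
    simp only [Fin.mk_one]
    conv_rhs => rw [this]
    module

lemma exists_omega (K : Type) [Field K] [NumberField K] (hrank : Module.finrank ℚ K = 2) :
    ∃ (B : Module.Basis (Fin 2) ℤ (NumberField.RingOfIntegers K)) (c e : ℤ), B 0 = 1 ∧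
      B 1 ^ 2 = c + e * B 1 ∧ e ^ 2 + 4 * c = NumberField.discr K := by
  obtain ⟨B, hB⟩ := exists_basis K hrank
  have hex : ∀ z, z = ((B.repr z 0 : ℤ) : NumberField.RingOfIntegers K) + (B.repr z 1 : ℤ) * B 1 := by
    intro z
    have := B.sum_repr z
    rw [Fin.sum_univ_two, hB] at this
    conv_lhs => rw [← this]
    simp
  obtain ⟨c, hc⟩ : ∃ c, c = B.repr (B 1 ^ 2) 0 := ⟨_, rfl⟩
  obtain ⟨e, he⟩ : ∃ e, e = B.repr (B 1 ^ 2) 1 := ⟨_, rfl⟩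
  have hsq : B 1 ^ 2 = c + e * B 1 := by rw [hc, he]; exact hex _
  refine ⟨B, c, e, hB, hsq, ?_⟩
  rw [← NumberField.discr_eq_discr K B, Algebra.discr_def, Matrix.det_fin_two]
  have t1 : Algebra.trace ℤ (NumberField.RingOfIntegers K) 1 = 2 := by
    have := Algebra.trace_algebraMap_of_basis B (1 : ℤ)
    simpa using this
  have tw : Algebra.trace ℤ (NumberField.RingOfIntegers K) (B 1) = e := by
    rw [Algebra.trace_eq_matrix_trace B, Matrix.trace_fin_two, Algebra.leftMulMatrix_eq_repr_mul,
      Algebra.leftMulMatrix_eq_repr_mul, hB, mul_one, ← sq, ← he]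
    simp
  have tw2 : Algebra.trace ℤ (NumberField.RingOfIntegers K) (B 1 ^ 2) = 2 * c + e * e := by
    rw [hsq, map_add]
    have e1 : ((c : ℤ) : NumberField.RingOfIntegers K) = c • 1 := by simp
    rw [e1, map_smul, ← zsmul_eq_mul, map_smul, t1, tw]
    simp; ring
  simp only [Algebra.traceMatrix_apply, Algebra.traceForm_apply, hB, one_mul, mul_one]
  rw [t1, tw, ← sq, tw2]
  ring

section
variable {K : Type} [Field K] [NumberField K]
  (B : Module.Basis (Fin 2) ℤ (NumberField.RingOfIntegers K)) (c e : ℤ) (hB : B 0 = 1)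
  (hsq : B 1 ^ 2 = c + e * B 1)

include hB hsq in
lemma absNorm_root (p : ℕ) (hp : p.Prime) (a : ℤ) (ha : (p : ℤ) ∣ a ^ 2 - e * a - c) :
    Ideal.absNorm (Ideal.span {(p : NumberField.RingOfIntegers K), B 1 - a}) = p := by
  set P := Ideal.span {(p : NumberField.RingOfIntegers K), B 1 - a} with hP
  have hpP : (p : NumberField.RingOfIntegers K) ∈ P := Ideal.subset_span (by simp)
  have hwP : B 1 - a ∈ P := Ideal.subset_span (by simp)
  have hne : P ≠ ⊤ := by
    intro h
    rw [Ideal.eq_top_iff_one, hP, Ideal.mem_span_pair] at h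
    obtain ⟨β, γ, h⟩ := h
    obtain ⟨m, hm⟩ := ha
    have hm' : (a : NumberField.RingOfIntegers K) ^ 2 - e * a - c = p * m := by exact_mod_cast congrArg (Int.cast : ℤ → NumberField.RingOfIntegers K) hm
    have h2 : (p : ℤ) • (β * (e - B 1 - a) + γ * m) = (e - a) • B 0 - (1 : ℤ) • B 1 := by
      rw [hB]
      simp only [zsmul_eq_mul, Int.cast_natCast, Int.cast_sub, Int.cast_one, one_mul, mul_one]
      linear_combination (e - B 1 - a) * h - γ * hm' + γ * hsq
    have h3 := congrArg (fun z => B.repr z 1) h2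
    simp only [map_sub, map_smul, Finsupp.coe_smul, Finsupp.coe_sub, Pi.smul_apply, Pi.sub_apply,
      Module.Basis.repr_self, smul_eq_mul] at h3
    simp only [ne_eq, one_ne_zero, not_false_eq_true, Finsupp.single_eq_of_ne,
      Finsupp.single_eq_same, mul_zero, mul_one, zero_sub] at h3
    have : (p : ℤ) ∣ 1 := by
      rw [← dvd_neg]; exact ⟨_, h3.symm⟩
    have := Int.le_of_dvd one_pos this
    have := hp.two_le
    omega
  have hcard : Nat.card (NumberField.RingOfIntegers K ⧸ P) ∣ p := by
    have hz : (Int.castAddHom (NumberField.RingOfIntegers K ⧸ P)) p = 0 := by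
      have := Ideal.Quotient.eq_zero_iff_mem.2 hpP
      simpa using this
    let φ : ZMod p →+ (NumberField.RingOfIntegers K ⧸ P) := ZMod.lift p ⟨_, hz⟩
    have hφ : Function.Surjective φ := by
      intro q
      obtain ⟨z, rfl⟩ := Ideal.Quotient.mk_surjective q
      refine ⟨((B.repr z 0 + B.repr z 1 * a : ℤ) : ZMod p), ?_⟩
      rw [ZMod.lift_coe]
      have h1 := B.sum_repr z
      rw [Fin.sum_univ_two, hB] at h1
      have h2 : Ideal.Quotient.mk P (((B.repr z 0 + B.repr z 1 * a : ℤ) : NumberField.RingOfIntegers K)) = Ideal.Quotient.mk P z := by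
        rw [Ideal.Quotient.eq]
        have : ((B.repr z 0 + B.repr z 1 * a : ℤ) : NumberField.RingOfIntegers K) - z = (-(B.repr z 1 : ℤ) : NumberField.RingOfIntegers K) * (B 1 - a) := by
          simp only [zsmul_eq_mul] at h1
          push_cast
          linear_combination h1
        rw [this]
        exact P.mul_mem_left _ hwP
      rw [← h2]
      simp
    have := AddSubgroup.card_dvd_of_surjective φ hφ
    rwa [Nat.card_zmod] at this
  have h1 : Ideal.absNorm P = Nat.card (NumberField.RingOfIntegers K ⧸ P) := by
    rw [Ideal.absNorm_apply, Submodule.cardQuot_apply]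
  rw [← h1, Nat.dvd_prime hp] at hcard
  rcases hcard with h | h
  · exact absurd (Ideal.absNorm_eq_one_iff.1 h) hne
  · exact h

include hB hsq in
lemma root_ne (p : ℕ) (hp : p.Prime) (a b : ℤ) (ha : (p : ℤ) ∣ a ^ 2 - e * a - c) 
    (hab : ¬ (p : ℤ) ∣ a - b) :
    Ideal.span {(p : NumberField.RingOfIntegers K), B 1 - a} ≠ 
    Ideal.span {(p : NumberField.RingOfIntegers K), B 1 - b} := by
  intro h
  have hN := absNorm_root B c e hB hsq p hp a ha
  set P := Ideal.span {(p : NumberField.RingOfIntegers K), B 1 - a} with hP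
  have hpP : (p : NumberField.RingOfIntegers K) ∈ P := Ideal.subset_span (by simp)
  have hwP : B 1 - a ∈ P := Ideal.subset_span (by simp)
  have hwb : B 1 - b ∈ P := by rw [h]; exact Ideal.subset_span (by simp)
  have hd : (a : NumberField.RingOfIntegers K) - b ∈ P := by
    have := P.sub_mem hwb hwP
    convert this using 1; ring
  obtain ⟨u, v, huv⟩ := ((Nat.prime_iff_prime_int.1 hp).coprime_iff_not_dvd).2 hab
  have h1 : (1 : NumberField.RingOfIntegers K) ∈ P := by
    have : (1 : NumberField.RingOfIntegers K) = u * p + v * (a - b) := by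
      exact_mod_cast (congrArg (Int.cast : ℤ → NumberField.RingOfIntegers K) huv).symm
    rw [this]
    exact P.add_mem (P.mul_mem_left _ hpP) (P.mul_mem_left _ hd)
  rw [(Ideal.eq_top_iff_one P).2 h1] at hN
  simp at hN
  exact hp.one_lt.ne hN
end

lemma exists_prime_of_dvd (K : Type) [Field K] [NumberField K] (hrank : Module.finrank ℚ K = 2)
    (d : ℕ) (hdisc : NumberField.discr K = -(d : ℤ)) (p : ℕ) (hp : p.Prime) (hpd : p ∣ d) :
    ∃ P : Ideal (NumberField.RingOfIntegers K), Ideal.absNorm P = p := by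
  obtain ⟨B, c, e, hB, hsq, hce⟩ := exists_omega K hrank
  rw [hdisc] at hce
  have hpd' : (p : ℤ) ∣ d := by exact_mod_cast hpd
  suffices ∃ a : ℤ, (p : ℤ) ∣ a ^ 2 - e * a - c by
    obtain ⟨a, ha⟩ := this
    exact ⟨_, absNorm_root B c e hB hsq p hp a ha⟩
  have hpp := Nat.prime_iff_prime_int.1 hp
  rcases hp.eq_two_or_odd with h2 | h2
  · subst h2
    have he : (2 : ℤ) ∣ e := by
      apply Int.prime_two.dvd_of_dvd_pow (n := 2)
      push_cast at hpd'
      omega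
    refine ⟨c, ?_⟩
    have h3 : (2 : ℤ) ∣ c * (c - 1) := (Int.even_mul_pred_self c).two_dvd
    have : c ^ 2 - e * c - c = c * (c - 1) - e * c := by ring
    rw [this]
    exact dvd_sub h3 (he.mul_right c)
  · obtain ⟨k, hk⟩ : ∃ k : ℤ, (p : ℤ) = 2 * k + 1 := ⟨p / 2, by omega⟩
    refine ⟨e * (k + 1), ?_⟩
    have h4 : (p : ℤ) ∣ 4 * ((e * (k + 1)) ^ 2 - e * (e * (k + 1)) - c) := by
      have : 4 * ((e * (k + 1)) ^ 2 - e * (e * (k + 1)) - c) = p * (e ^ 2 * p) + d := by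
        rw [hk]; linear_combination (-1 : ℤ) * hce
      rw [this]
      exact dvd_add (dvd_mul_right _ _) hpd'
    refine (hpp.dvd_or_dvd h4).resolve_left ?_
    intro h5
    have : (p : ℤ) ∣ 2 := hpp.dvd_of_dvd_pow (n := 2) (by norm_num; exact h5)
    have := Int.le_of_dvd (by norm_num) this
    have := hp.two_le
    omega

lemma exists_primes_of_split (K : Type) [Field K] [NumberField K] (hrank : Module.finrank ℚ K = 2)
    (d : ℕ) (hdisc : NumberField.discr K = -(d : ℤ)) (p : ℕ) (hp : p.Prime) (hpd : ¬ p ∣ d)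
    (h2 : p = 2 → d % 8 = 7) (hodd : p ≠ 2 → @legendreSym p ⟨hp⟩ (-(d : ℤ)) = 1) :
    ∃ P Q : Ideal (NumberField.RingOfIntegers K), 
      Ideal.absNorm P = p ∧ Ideal.absNorm Q = p ∧ P ≠ Q := by
  obtain ⟨B, c, e, hB, hsq, hce⟩ := exists_omega K hrank
  rw [hdisc] at hce
  suffices ∃ a b : ℤ, (p : ℤ) ∣ a ^ 2 - e * a - c ∧ (p : ℤ) ∣ b ^ 2 - e * b - c ∧
      ¬ (p : ℤ) ∣ a - b by
    obtain ⟨a, b, ha, hb, hab⟩ := this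
    exact ⟨_, _, absNorm_root B c e hB hsq p hp a ha, absNorm_root B c e hB hsq p hp b hb,
      root_ne B c e hB hsq p hp a b ha hab⟩
  have hpp := Nat.prime_iff_prime_int.1 hp
  by_cases hp2 : p = 2
  · have h7 := h2 hp2
    subst hp2
    have he : e % 2 = 1 := by
      by_contra h
      have : e ^ 2 % 2 = 0 := by
        rw [sq, Int.mul_emod, show e % 2 = 0 by omega]; rfl
      omega
    have he8 : e ^ 2 % 8 = 1 := by
      rw [sq, Int.mul_emod]
      have : e % 8 = 1 ∨ e % 8 = 3 ∨ e % 8 = 5 ∨ e % 8 = 7 := by omega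
      rcases this with h | h | h | h <;> rw [h] <;> rfl
    have hc2 : (2 : ℤ) ∣ c := by omega
    refine ⟨0, 1, ?_, ?_, ?_⟩
    · simpa using hc2
    · simp only [one_pow, mul_one]; push_cast; omega
    · push_cast; decide
  · have hl := hodd hp2
    have : Fact p.Prime := ⟨hp⟩
    obtain ⟨k, hk⟩ : ∃ k : ℤ, (p : ℤ) = 2 * k + 1 := ⟨p / 2, by
      have := hp.eq_two_or_odd
      omega⟩
    have h0 : ((-(d : ℤ) : ℤ) : ZMod p) ≠ 0 := by
      intro h
      rw [(ZMod.intCast_zmod_eq_zero_iff_dvd _ p)] at h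
      rw [dvd_neg] at h
      exact hpd (by exact_mod_cast h)
    rw [legendreSym.eq_one_iff p h0] at hl
    obtain ⟨y, hy⟩ := hl
    obtain ⟨y, rfl⟩ := ZMod.intCast_surjective y
    have hyd : (p : ℤ) ∣ y ^ 2 + d := by
      rw [← ZMod.intCast_zmod_eq_zero_iff_dvd]
      push_cast at hy ⊢
      rw [sq, ← hy]; ring
    have hp4 : ¬ (p : ℤ) ∣ 4 := by
      intro h5
      have : (p : ℤ) ∣ 2 := hpp.dvd_of_dvd_pow (n := 2) (by norm_num; exact h5)
      have := Int.le_of_dvd (by norm_num) this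
      have := hp.two_le
      omega
    have hy0 : ¬ (p : ℤ) ∣ y := by
      intro h
      have : (p : ℤ) ∣ d := by
        have := dvd_sub hyd (h.pow (two_ne_zero))
        rwa [add_sub_cancel_left] at this
      exact hpd (by exact_mod_cast this)
    have gen : ∀ z : ℤ, (p : ℤ) ∣ z ^ 2 + d → 
        (p : ℤ) ∣ ((e + z) * (k + 1)) ^ 2 - e * ((e + z) * (k + 1)) - c := by
      intro z hz
      refine (hpp.dvd_or_dvd (a := 4) ?_).resolve_left hp4
      have : 4 * (((e + z) * (k + 1)) ^ 2 - e * ((e + z) * (k + 1)) - c) = 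
          (z ^ 2 + d) + p * ((e + z) * ((e + z) * p + 2 * z)) := by
        rw [hk]; linear_combination (-1 : ℤ) * hce
      rw [this]
      exact dvd_add hz (dvd_mul_right _ _)
    refine ⟨_, _, gen y hyd, gen (-y) (by rwa [neg_sq]), ?_⟩
    have : (e + y) * (k + 1) - (e + -y) * (k + 1) = p * y + y := by rw [hk]; ring
    rw [this]
    intro h
    exact hy0 ((dvd_add_right (dvd_mul_right _ _)).1 h)

open NumberField in
lemma residue_le (K : Type) [Field K] [NumberField K] (hrank : Module.finrank ℚ K = 2)
    (d : ℕ) (hd : 0 < d) (hdisc : NumberField.discr K = -(d : ℤ)) :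
    NumberField.dedekindZeta_residue K ≤ π * NumberField.classNumber K / √(d : ℝ) := by
  have hs := NumberField.sign_discr K
  have hadd := InfinitePlace.card_add_two_mul_card_eq_rank K
  rw [hrank] at hadd
  rw [hdisc, Int.sign_neg, Int.sign_natCast_of_ne_zero hd.ne'] at hs
  have hc : InfinitePlace.nrComplexPlaces K = 1 := by
    have h0 : InfinitePlace.nrComplexPlaces K ≠ 0 := by
      intro h; rw [h] at hs; norm_num at hs
    omega
  have hr : InfinitePlace.nrRealPlaces K = 0 := by omega
  have hrk : Units.rank K = 0 := by
    rw [Units.rank, InfinitePlace.card_eq_nrRealPlaces_add_nrComplexPlaces, hc, hr]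
  have hreg : Units.regulator K = 1 := by
    classical
    have : IsEmpty (Fin (Units.rank K)) := by rw [hrk]; infer_instance
    rw [Units.regulator_eq_det']
    have h2 := (Units.equivFinRank K).symm.isEmpty
    rw [Matrix.det_isEmpty, abs_one]
  have htor : (2 : ℝ) ≤ Units.torsionOrder K := by
    have h1 := (Units.even_torsionOrder K).two_dvd
    exact_mod_cast Nat.le_of_dvd (Units.torsionOrder_pos K) h1
  rw [dedekindZeta_residue_def, hc, hr, hreg, hdisc]
  have hsd : |((-(d : ℤ) : ℤ) : ℝ)| = d := by push_cast; rw [abs_neg]; simp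
  rw [hsd]
  have hsq : 0 < √(d : ℝ) := by positivity
  rw [div_le_div_iff₀ (by positivity) hsq]
  simp only [pow_zero, pow_one, one_mul, mul_one]
  have : 0 ≤ π * (classNumber K : ℝ) * √(d : ℝ) := by positivity
  nlinarith

open NumberTheorySymbols in
lemma exists_jac (k : ℕ) [NeZero k] : ∃ ψ : DirichletCharacter ℤ k,
    ∀ n : ℤ, ψ (n : ZMod k) = J(n | k) := by
  have hval : ∀ n : ℤ, J(((n : ZMod k).val : ℤ) | k) = J(n | k) := by
    intro n
    rw [ZMod.val_intCast, ← jacobiSym.mod_left]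
  refine ⟨{ toFun := fun x => J((x.val : ℤ) | k), map_one' := ?_, map_mul' := ?_,
            map_nonunit' := ?_ }, hval⟩
  · have := hval 1
    simpa [jacobiSym.one_left] using this
  · intro x y
    rw [← jacobiSym.mul_left, ← hval (x.val * y.val)]
    simp
  · intro x hx
    rw [jacobiSym.eq_zero_iff_not_coprime]
    intro h
    apply hx
    rw [← ZMod.natCast_zmod_val x, ZMod.isUnit_iff_coprime]
    exact_mod_cast h

open NumberTheorySymbols in
lemma exists_psi (d q k : ℕ) [NeZero d] [NeZero k] (hq : q ∣ d) (hk : k ∣ d)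
    (α : DirichletCharacter ℤ q) : ∃ ψ : DirichletCharacter ℤ d,
    ∀ n : ℤ, IsCoprime n (d : ℤ) → ψ (n : ZMod d) = α (n : ZMod q) * J(n | k) := by
  obtain ⟨φ, hφ⟩ := exists_jac k
  refine ⟨DirichletCharacter.changeLevel hq α * DirichletCharacter.changeLevel hk φ, ?_⟩
  intro n hn
  have hu : IsUnit (n : ZMod d) := by
    rw [ZMod.coe_int_isUnit_iff_isCoprime]; exact hn.symm
  obtain ⟨u, hu⟩ := hu
  rw [MulChar.mul_apply, ← hu, DirichletCharacter.changeLevel_eq_cast_of_dvd,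
    DirichletCharacter.changeLevel_eq_cast_of_dvd, hu, ZMod.cast_intCast hq, ZMod.cast_intCast hk, hφ]

open NumberTheorySymbols in
lemma recip_three (k p : ℕ) (hk : k % 4 = 3) (hp : p % 2 = 1) : J(-(k : ℤ) | p) = J(p | k) := by
  rw [jacobiSym.neg _ (Nat.odd_iff.2 hp)]
  have : p % 4 = 1 ∨ p % 4 = 3 := by omega
  rcases this with h | h
  · rw [ZMod.χ₄_nat_one_mod_four h, one_mul,
      jacobiSym.quadratic_reciprocity_one_mod_four' (Nat.odd_iff.2 (by omega)) h]
  · rw [ZMod.χ₄_nat_three_mod_four h, jacobiSym.quadratic_reciprocity_three_mod_four hk h]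
    ring

open NumberTheorySymbols in
lemma exists_psi' (d : ℕ) [NeZero d] (hfund : IsFundamentalDiscriminant (-(d : ℤ))) :
    ∃ ψ : DirichletCharacter ℤ d, ψ (-1) = -1 ∧
      (∀ p : ℕ, p.Prime → p ≠ 2 → ¬ p ∣ d → ψ p = J(-(d : ℤ) | p)) ∧
      (d % 2 = 1 → d % 4 = 3 ∧ ψ 2 = J(2 | d)) := by
  have hm1 : IsCoprime (-1 : ℤ) (d : ℤ) := isCoprime_one_left.neg_left
  have hcop : ∀ p : ℕ, p.Prime → ¬ p ∣ d → IsCoprime (p : ℤ) (d : ℤ) := fun p hp hpd =>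
    Nat.isCoprime_iff_coprime.2 ((Nat.Prime.coprime_iff_not_dvd hp).2 hpd)
  have hodd : ∀ p : ℕ, p.Prime → p ≠ 2 → p % 2 = 1 := fun p hp h2 =>
    hp.eq_two_or_odd.resolve_left h2
  have hd0 : d ≠ 0 := NeZero.ne d
  rcases hfund with ⟨h, -⟩ | ⟨h, -, h2⟩
  · have hd4 : d % 4 = 3 := by omega
    obtain ⟨ψ, hψ⟩ := exists_psi d 1 d (one_dvd _) dvd_rfl 1
    have hone : ∀ x : ZMod 1, (1 : DirichletCharacter ℤ 1) x = 1 := fun x => by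
      rw [Subsingleton.elim x 1, map_one]
    refine ⟨ψ, ?_, ?_, ?_⟩
    · have := hψ (-1) hm1
      rw [hone, jacobiSym.at_neg_one (Nat.odd_iff.2 (by omega)), ZMod.χ₄_nat_three_mod_four hd4] at this
      simpa using this
    · intro p hp hp2 hpd
      have := hψ p (hcop p hp hpd)
      rw [hone, one_mul, ← recip_three d p hd4 (hodd p hp hp2)] at this
      simpa using this
    · intro hd2
      refine ⟨hd4, ?_⟩
      have := hψ 2 (by exact_mod_cast hcop 2 Nat.prime_two (by omega))
      rw [hone, one_mul] at this
      simpa using this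
  · obtain ⟨m, rfl⟩ : ∃ m, d = 4 * m := ⟨d / 4, by omega⟩
    have hm : m % 4 = 1 ∨ m % 4 = 2 := by omega
    rcases hm with hm | hm
    · have : NeZero m := ⟨by omega⟩
      obtain ⟨ψ, hψ⟩ := exists_psi (4 * m) 4 m (dvd_mul_right _ _) (dvd_mul_left _ _) ZMod.χ₄
      refine ⟨ψ, ?_, ?_, by omega⟩
      · have := hψ (-1) hm1
        rw [jacobiSym.at_neg_one (Nat.odd_iff.2 (by omega)), ZMod.χ₄_nat_one_mod_four hm] at this
        rw [show ((-1 : ℤ) : ZMod (4 * m)) = -1 by simp] at this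
        rw [this]; decide
      · intro p hp hp2 hpd
        have := hψ p (hcop p hp hpd)
        have hpo := hodd p hp hp2
        rw [jacobiSym.neg _ (Nat.odd_iff.2 hpo)]
        push_cast
        rw [jacobiSym.mul_left, jacobiSym.at_four (Nat.odd_iff.2 hpo), one_mul,
          jacobiSym.quadratic_reciprocity_one_mod_four hm (Nat.odd_iff.2 hpo)]
        simpa using this
    · obtain ⟨k, rfl⟩ : ∃ k, m = 2 * k := ⟨m / 2, by omega⟩
      have : NeZero k := ⟨by omega⟩
      have hk : k % 4 = 1 ∨ k % 4 = 3 := by omega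
      have h8 : 8 ∣ 4 * (2 * k) := ⟨k, by ring⟩
      have hkd : k ∣ 4 * (2 * k) := ⟨8, by ring⟩
      rcases hk with hk | hk
      · obtain ⟨ψ, hψ⟩ := exists_psi (4 * (2 * k)) 8 k h8 hkd ZMod.χ₈'
        refine ⟨ψ, ?_, ?_, by omega⟩
        · have := hψ (-1) hm1
          rw [jacobiSym.at_neg_one (Nat.odd_iff.2 (by omega)), ZMod.χ₄_nat_one_mod_four hk] at this
          rw [show ((-1 : ℤ) : ZMod (4 * (2 * k))) = -1 by simp] at this
          rw [this]; decide
        · intro p hp hp2 hpd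
          have := hψ p (hcop p hp hpd)
          have hpo := hodd p hp hp2
          have e : (-((4 * (2 * k) : ℕ) : ℤ)) = 4 * (-2 * k) := by push_cast; ring
          rw [e, jacobiSym.mul_left, jacobiSym.mul_left, jacobiSym.at_four (Nat.odd_iff.2 hpo), one_mul,
            jacobiSym.at_neg_two (Nat.odd_iff.2 hpo),
            jacobiSym.quadratic_reciprocity_one_mod_four hk (Nat.odd_iff.2 hpo)]
          simpa using this
      · obtain ⟨ψ, hψ⟩ := exists_psi (4 * (2 * k)) 8 k h8 hkd ZMod.χ₈
        refine ⟨ψ, ?_, ?_, by omega⟩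
        · have := hψ (-1) hm1
          rw [jacobiSym.at_neg_one (Nat.odd_iff.2 (by omega)), ZMod.χ₄_nat_three_mod_four hk] at this
          rw [show ((-1 : ℤ) : ZMod (4 * (2 * k))) = -1 by simp] at this
          rw [this]; decide
        · intro p hp hp2 hpd
          have := hψ p (hcop p hp hpd)
          have hpo := hodd p hp hp2
          have e : (-((4 * (2 * k) : ℕ) : ℤ)) = 4 * (2 * (-k)) := by push_cast; ring
          rw [e, jacobiSym.mul_left, jacobiSym.mul_left, jacobiSym.at_four (Nat.odd_iff.2 hpo), one_mul,
            jacobiSym.at_two (Nat.odd_iff.2 hpo), recip_three k p hk hpo]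
          simpa using this

lemma exists_chi (d : ℕ) [NeZero d] (hfund : IsFundamentalDiscriminant (-(d : ℤ))) :
    ∃ χ : DirichletCharacter ℂ d, IsQuadFieldChar d χ ∧ χ ≠ 1 ∧
      (∀ p : ℕ, p.Prime → χ p = 0 ∨ χ p = 1 ∨ χ p = -1) ∧
      (∀ p : ℕ, p.Prime → χ p = 0 → p ∣ d) ∧
      (¬ 2 ∣ d → χ 2 = 1 → d % 8 = 7) := by
  obtain ⟨ψ, h1, h2, h3⟩ := exists_psi' d hfund
  have happ : ∀ x, (ψ.ringHomComp (Int.castRingHom ℂ)) x = ((ψ x : ℤ) : ℂ) := fun x => by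
    rw [MulChar.ringHomComp_apply]; rfl
  refine ⟨ψ.ringHomComp (Int.castRingHom ℂ), ?_, ?_, ?_, ?_, ?_⟩
  · intro p hp hp2 hpd
    rw [happ, h2 p hp hp2 hpd]
    have : Fact p.Prime := ⟨hp⟩
    rw [jacobiSym.legendreSym.to_jacobiSym]
  · intro h
    have := happ (-1)
    rw [h, h1, MulChar.one_apply (isUnit_one.neg)] at this
    norm_num at this
  · intro p hp
    by_cases hpd : p ∣ d
    · left
      apply MulChar.map_nonunit
      rw [ZMod.isUnit_iff_coprime, Nat.Prime.coprime_iff_not_dvd hp]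
      exact not_not.2 hpd
    · rw [happ]
      have key : ∃ a b, ψ p = jacobiSym a b := by
        by_cases hp2 : p = 2
        · subst hp2
          exact ⟨_, _, by simpa using (h3 (by omega)).2⟩
        · exact ⟨_, _, h2 p hp hp2 hpd⟩
      obtain ⟨a, b, hab⟩ := key
      rw [hab]
      rcases jacobiSym.trichotomy a b with h | h | h <;> rw [h] <;> simp
  · intro p hp h
    by_contra hpd
    have hu : IsUnit (p : ZMod d) := by
      rw [ZMod.isUnit_iff_coprime, Nat.Prime.coprime_iff_not_dvd hp]
      exact hpd
    exact ((hu.map (ψ.ringHomComp (Int.castRingHom ℂ))).ne_zero) h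
  · intro hd h
    obtain ⟨h4, h5⟩ := h3 (by omega)
    rw [happ, h5, jacobiSym.at_two (Nat.odd_iff.2 (by omega)), ZMod.χ₈_nat_eq_if_mod_eight] at h
    by_contra h7
    rw [if_neg (by omega), if_neg (by omega)] at h
    norm_num at h

/-- Assuming the Conrey–Iwaniec bound `L(1, χ_{d'}) ≥ 1/(log d')^18` for all negative
fundamental discriminants `-d'`, any fundamental discriminant `-d` whose class group has one
class per genus (`h(-d) = 2^(g-1)` with `g` the number of prime divisors of `d`) satisfies
`d ≤ d₆₆`, the product of the first 66 primes. -/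
theorem one_class_per_genus_bound
    (hCI : ∀ (d' : ℕ) (_ : NeZero d'), IsFundamentalDiscriminant (-(d' : ℤ)) →
      ∀ χ' : DirichletCharacter ℂ d', IsQuadFieldChar d' χ' →
        (1 : ℝ) / (Real.log d') ^ 18 ≤ (DirichletCharacter.LFunction χ' 1).re)
    (d : ℕ) [NeZero d] (hd : 4 < d) (hfund : IsFundamentalDiscriminant (-(d : ℤ)))
    (K : Type) [Field K] [NumberField K]
    (hrank : Module.finrank ℚ K = 2) (hdisc : NumberField.discr K = -(d : ℤ))
    (hgenus : NumberField.classNumber K = 2 ^ (d.primeFactors.card - 1)) :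
    d ≤ ∏ i ∈ Finset.range 66, Nat.nth Nat.Prime i := by
  by_contra hlt
  push Not at hlt
  obtain ⟨χ, hχq, hχ1, htri, hz, h8⟩ := exists_chi d hfund
  have hL := hCI d inferInstance hfund χ hχq
  have hc := coeff_bound K d χ (fun p k hp => prime_pow_bound K hrank d χ p k hp (htri p hp)
    (fun h => exists_prime_of_dvd K hrank d hdisc p hp (hz p hp h))
    (fun h => by
      have hpd : ¬ p ∣ d := by
        intro hdv
        have : χ (p : ZMod d) = 0 := by
          apply MulChar.map_nonunit
          rw [ZMod.isUnit_iff_coprime, Nat.Prime.coprime_iff_not_dvd hp]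
          exact fun h' => h' hdv
        rw [this] at h
        exact zero_ne_one h
      refine exists_primes_of_split K hrank d hdisc p hp hpd ?_ ?_
      · intro h2
        subst h2
        exact h8 hpd (by exact_mod_cast h)
      · intro hp2
        have := hχq p hp hp2 hpd
        rw [h] at this
        exact_mod_cast this.symm))
  have h1 := L_le_residue K d χ hχ1 hc
  have h2 := residue_le K hrank d (by omega) hdisc
  rw [hgenus] at h2
  have h3 := (hL.trans h1).trans h2
  have hlog : 0 < Real.log d := Real.log_pos (by exact_mod_cast (by omega : 1 < d))
  have hs : 0 < √(d : ℝ) := Real.sqrt_pos.mpr (by exact_mod_cast (by omega : 0 < d))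
  rw [div_le_div_iff₀ (by positivity) hs, one_mul] at h3
  push_cast at h3
  exact numeric d _ (d_ge d (NeZero.ne d) hlt) h3
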